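/- Let G=(V,E) be a finite undirected simple graph with positive symmetric edge weights w and let Ȳ be an edge flow on G. Suppose s : V → ℝ minimizes F(s) = Σ_{{i,j}∈E} w_{ij} (s_j − s_i − Ȳ(i,j))², and let R = Ȳ − grad s be the residual edge flow. Then R is divergence-free: (div R)(i) = 0 for every vertex i. Moreover R decomposes uniquely as R = h + c where h is an edge flow with curl h = 0 and div h = 0 (harmonic component, accounting for global inconsistencies) and c is an edge flow with ⟨c, Z⟩_w = 0 for every curl-free edge flow Z (locally cyclic component, accounting for local inconsistencies), and ⟨h, c⟩_w = 0. -/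

import Mathlib

open Finset

/-- `X` is an edge flow on `G`: skew-symmetric on edges and zero off edges. -/
def IsEdgeFlow {V : Type*} (G : SimpleGraph V) (X : V → V → ℝ) : Prop :=
  (∀ i j, G.Adj i j → X i j = - X j i) ∧ ∀ i j, ¬ G.Adj i j → X i j = 0

/-- The gradient flow of a potential `s` on `G`. -/
noncomputable def gradFlow {V : Type*} (G : SimpleGraph V) [DecidableRel G.Adj]
    (s : V → ℝ) : V → V → ℝ :=
  fun i j => if G.Adj i j then s j - s i else 0

/-- The combinatorial curl of an edge flow on `G`. -/
noncomputable def curlFlow {V : Type*} (G : SimpleGraph V) [DecidableRel G.Adj]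
    (X : V → V → ℝ) : V → V → V → ℝ :=
  fun i j k => if G.Adj i j ∧ G.Adj j k ∧ G.Adj k i then X i j + X j k + X k i else 0

/-- The weighted divergence of an edge flow. -/
noncomputable def divW {V : Type*} [Fintype V] (G : SimpleGraph V) [DecidableRel G.Adj]
    (w X : V → V → ℝ) : V → ℝ :=
  fun i => ∑ j, if G.Adj i j then w i j * X i j else 0

/-- The weighted inner product of edge flows (each unordered edge counted once). -/
noncomputable def innerW {V : Type*} [Fintype V] (G : SimpleGraph V) [DecidableRel G.Adj]
    (w X Y : V → V → ℝ) : ℝ :=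
  (1 / 2) * ∑ i, ∑ j, if G.Adj i j then w i j * X i j * Y i j else 0

/-- The weighted least squares objective (each unordered edge counted once). -/
noncomputable def lsObj {V : Type*} [Fintype V] (G : SimpleGraph V) [DecidableRel G.Adj]
    (w Y : V → V → ℝ) (s : V → ℝ) : ℝ :=
  (1 / 2) * ∑ i, ∑ j, if G.Adj i j then w i j * (s j - s i - Y i j) ^ 2 else 0

section EdgeFlow

variable {V : Type*} (G : SimpleGraph V)

/-- The space of curl-free edge flows on `G`. -/
def curlFreeFlows [DecidableRel G.Adj] : Submodule ℝ (V → V → ℝ) where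
  carrier := {X | IsEdgeFlow G X ∧ curlFlow G X = 0}
  zero_mem' := by
    refine ⟨⟨by simp, by simp⟩, ?_⟩
    funext i j k
    simp [curlFlow]
  add_mem' := by
    rintro X Y ⟨⟨hX, hX'⟩, hXc⟩ ⟨⟨hY, hY'⟩, hYc⟩
    refine ⟨⟨fun i j h => ?_, fun i j h => ?_⟩, ?_⟩
    · simp only [Pi.add_apply]
      linarith [hX i j h, hY i j h]
    · simp [hX' i j h, hY' i j h]
    · funext i j k
      have h1 := congrFun (congrFun (congrFun hXc i) j) k
      have h2 := congrFun (congrFun (congrFun hYc i) j) k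
      simp only [curlFlow, Pi.zero_apply, Pi.add_apply] at *
      split_ifs at * <;> linarith
  smul_mem' := by
    rintro a X ⟨⟨hX, hX'⟩, hXc⟩
    refine ⟨⟨fun i j h => ?_, fun i j h => ?_⟩, ?_⟩
    · simp [hX i j h]
    · simp [hX' i j h]
    · funext i j k
      have h1 := congrFun (congrFun (congrFun hXc i) j) k
      simp only [curlFlow, Pi.zero_apply, Pi.smul_apply, smul_eq_mul] at *
      split_ifs at *
      · linear_combination a * h1
      · rfl

variable {G}

theorem mem_curlFreeFlows [DecidableRel G.Adj] {X : V → V → ℝ} :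
    X ∈ curlFreeFlows G ↔ IsEdgeFlow G X ∧ curlFlow G X = 0 :=
  Iff.rfl

theorem IsEdgeFlow.sub {X Y : V → V → ℝ} (hX : IsEdgeFlow G X) (hY : IsEdgeFlow G Y) :
    IsEdgeFlow G (X - Y) := by
  refine ⟨fun i j h => ?_, fun i j h => ?_⟩
  · simp only [Pi.sub_apply]
    linarith [hX.1 i j h, hY.1 i j h]
  · simp [hX.2 i j h, hY.2 i j h]

variable [DecidableRel G.Adj]

theorem gradFlow_mem_curlFreeFlows (t : V → ℝ) : gradFlow G t ∈ curlFreeFlows G := by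
  refine ⟨⟨fun i j h => ?_, fun i j h => ?_⟩, ?_⟩
  · simp [gradFlow, h, h.symm]
  · simp [gradFlow, h]
  · funext i j k
    by_cases h : G.Adj i j ∧ G.Adj j k ∧ G.Adj k i
    · simp only [curlFlow, gradFlow, h, and_self, if_true, Pi.zero_apply]
      ring
    · simp [curlFlow, h]

variable [Fintype V] {w : V → V → ℝ}

variable (G w) in
/-- The weighted inner product as a bilinear form on all functions `V → V → ℝ`. -/
noncomputable def innerWForm : LinearMap.BilinForm ℝ (V → V → ℝ) :=
  LinearMap.mk₂ ℝ (innerW G w)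
    (fun X X' Y => by
      simp only [innerW, ← mul_add, ← sum_add_distrib]
      refine congrArg _ (sum_congr rfl fun i _ => sum_congr rfl fun j _ => ?_)
      split_ifs
      · simp only [Pi.add_apply]
        ring
      · simp)
    (fun a X Y => by
      simp only [innerW, smul_eq_mul, mul_left_comm a, mul_sum]
      refine sum_congr rfl fun i _ => sum_congr rfl fun j _ => ?_
      split_ifs
      · simp only [Pi.smul_apply, smul_eq_mul]
        ring
      · simp)
    (fun X Y Y' => by
      simp only [innerW, ← mul_add, ← sum_add_distrib]
      refine congrArg _ (sum_congr rfl fun i _ => sum_congr rfl fun j _ => ?_)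
      split_ifs
      · simp only [Pi.add_apply]
        ring
      · simp)
    (fun a X Y => by
      simp only [innerW, smul_eq_mul, mul_left_comm a, mul_sum]
      refine sum_congr rfl fun i _ => sum_congr rfl fun j _ => ?_
      split_ifs
      · simp only [Pi.smul_apply, smul_eq_mul]
        ring
      · simp)

@[simp]
theorem innerWForm_apply (X Y : V → V → ℝ) : innerWForm G w X Y = innerW G w X Y :=
  rfl

theorem innerW_comm (X Y : V → V → ℝ) : innerW G w X Y = innerW G w Y X := by
  simp only [innerW, mul_right_comm]

theorem innerW_sub_left (X X' Y : V → V → ℝ) :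
    innerW G w (X - X') Y = innerW G w X Y - innerW G w X' Y := by
  simp only [← innerWForm_apply, map_sub, LinearMap.sub_apply]

theorem IsEdgeFlow.eq_zero_of_innerW_self (hw_pos : ∀ i j, G.Adj i j → 0 < w i j)
    {X : V → V → ℝ} (hX : IsEdgeFlow G X) (h : innerW G w X X = 0) : X = 0 := by
  have hnn : ∀ i j, 0 ≤ if G.Adj i j then w i j * X i j * X i j else 0 := by
    intro i j
    split_ifs with hij
    · nlinarith [mul_nonneg (hw_pos i j hij).le (mul_self_nonneg (X i j))]
    · rfl
  have hsum : ∑ i, ∑ j, (if G.Adj i j then w i j * X i j * X i j else 0) = 0 := by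
    unfold innerW at h
    linarith
  funext i j
  by_cases hij : G.Adj i j
  · rw [sum_eq_zero_iff_of_nonneg fun i _ => sum_nonneg fun j _ => hnn i j] at hsum
    have hi := (sum_eq_zero_iff_of_nonneg fun j _ => hnn i j).1 (hsum i (mem_univ i)) j (mem_univ j)
    simpa [hij, (hw_pos i j hij).ne'] using hi
  · exact hX.2 i j hij

/-- The negative divergence is adjoint to the gradient. -/
theorem innerW_gradFlow (hw_symm : ∀ i j, w i j = w j i) {X : V → V → ℝ}
    (hX : IsEdgeFlow G X) (t : V → ℝ) :
    innerW G w X (gradFlow G t) = -∑ i, t i * divW G w X i := by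
  have hswap : ∑ i, ∑ j, (if G.Adj i j then w i j * X i j * t j else 0) =
      -∑ i, t i * divW G w X i := by
    rw [sum_comm, ← sum_neg_distrib]
    refine sum_congr rfl fun i _ => ?_
    rw [divW, mul_sum, ← sum_neg_distrib]
    refine sum_congr rfl fun j _ => ?_
    by_cases h : G.Adj i j
    · simp only [h, h.symm, if_true]
      rw [hX.1 j i h.symm, hw_symm j i]
      ring
    · simp [h, G.adj_comm j i]
  have hsplit : ∑ i, ∑ j, (if G.Adj i j then w i j * X i j * gradFlow G t i j else 0) =
      ∑ i, ∑ j, (if G.Adj i j then w i j * X i j * t j else 0) -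
        ∑ i, t i * divW G w X i := by
    simp only [divW, mul_sum, ← sum_sub_distrib]
    refine sum_congr rfl fun i _ => sum_congr rfl fun j _ => ?_
    by_cases h : G.Adj i j
    · simp only [gradFlow, h, if_true]
      ring
    · simp [h]
  rw [innerW, hsplit, hswap]
  ring

theorem IsEdgeFlow.divW_eq_zero (hw_symm : ∀ i j, w i j = w j i) {X : V → V → ℝ}
    (hX : IsEdgeFlow G X) (h : ∀ t : V → ℝ, innerW G w X (gradFlow G t) = 0) :
    divW G w X = 0 := by
  classical
  funext i
  have hi := h (Pi.single i 1)
  rw [innerW_gradFlow hw_symm hX] at hi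
  simpa [Pi.single_apply] using hi

theorem lsObj_add_smul (Y : V → V → ℝ) (s t : V → ℝ) (ε : ℝ) :
    lsObj G w Y (s + ε • t) = lsObj G w Y s
      - 2 * ε * innerW G w (Y - gradFlow G s) (gradFlow G t)
      + ε ^ 2 * innerW G w (gradFlow G t) (gradFlow G t) := by
  simp only [lsObj, innerW, mul_left_comm _ (1 / 2 : ℝ), ← mul_sub, ← mul_add]
  congr 1
  simp only [mul_sum, ← sum_sub_distrib, ← sum_add_distrib]
  refine sum_congr rfl fun i _ => sum_congr rfl fun j _ => ?_
  by_cases h : G.Adj i j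
  · simp only [gradFlow, h, if_true, Pi.add_apply, Pi.sub_apply, Pi.smul_apply, smul_eq_mul]
    ring
  · simp [h]

/-- The residual of a least squares minimizer is orthogonal to all gradient flows. -/
theorem innerW_residual_gradFlow {Y : V → V → ℝ} {s : V → ℝ}
    (hmin : ∀ t : V → ℝ, lsObj G w Y s ≤ lsObj G w Y t) (t : V → ℝ) :
    innerW G w (Y - gradFlow G s) (gradFlow G t) = 0 := by
  set a := innerW G w (gradFlow G t) (gradFlow G t)
  set b := innerW G w (Y - gradFlow G s) (gradFlow G t)
  have key : ∀ ε : ℝ, 0 ≤ a * (ε * ε) + (-2 * b) * ε + 0 := fun ε => by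
    have h := hmin (s + ε • t)
    rw [lsObj_add_smul] at h
    linarith
  have hd := discrim_le_zero key
  rw [discrim] at hd
  nlinarith [sq_nonneg b]

theorem isCompl_curlFreeFlows_orthogonal (hw_pos : ∀ i j, G.Adj i j → 0 < w i j) :
    IsCompl (curlFreeFlows G) ((innerWForm G w).orthogonal (curlFreeFlows G)) := by
  have hrefl : (innerWForm G w).IsRefl := fun X Y h => by
    rwa [innerWForm_apply, innerW_comm]
  refine LinearMap.BilinForm.isCompl_orthogonal_of_restrict_nondegenerate hrefl
    ((LinearMap.IsRefl.nondegenerate_iff_separatingLeft (B := (innerWForm G w).restrict _)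
      fun X Y h => hrefl _ _ h).2 fun X hX => ?_)
  exact Subtype.ext (X.2.1.eq_zero_of_innerW_self hw_pos (hX X))

end EdgeFlow

/-- The residual `R = Y − grad s` of a weighted least squares minimizer `s` is
divergence-free, and it decomposes uniquely into the orthogonal sum of a harmonic
flow (curl-free and divergence-free, the global inconsistency) and a locally cyclic
flow (orthogonal to all curl-free flows, the local inconsistency). -/
theorem residual_divergence_free_and_decomposes {V : Type*} [Fintype V]
    (G : SimpleGraph V) [DecidableRel G.Adj] (w : V → V → ℝ)
    (hw_symm : ∀ i j, w i j = w j i) (hw_pos : ∀ i j, G.Adj i j → 0 < w i j)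
    (Y : V → V → ℝ) (hY : IsEdgeFlow G Y) (s : V → ℝ)
    (hmin : ∀ t : V → ℝ, lsObj G w Y s ≤ lsObj G w Y t) :
    divW G w (fun i j => Y i j - gradFlow G s i j) = 0 ∧
    ∃! p : (V → V → ℝ) × (V → V → ℝ),
      (IsEdgeFlow G p.1 ∧ curlFlow G p.1 = 0 ∧ divW G w p.1 = 0) ∧
      (IsEdgeFlow G p.2 ∧
        ∀ Z, IsEdgeFlow G Z → curlFlow G Z = 0 → innerW G w p.2 Z = 0) ∧
      (∀ i j, Y i j - gradFlow G s i j = p.1 i j + p.2 i j) ∧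
      innerW G w p.1 p.2 = 0 := by
  have hR : IsEdgeFlow G (Y - gradFlow G s) := hY.sub (gradFlow_mem_curlFreeFlows s).1
  have horth := innerW_residual_gradFlow hmin
  refine ⟨hR.divW_eq_zero hw_symm horth, ?_⟩
  obtain ⟨h, hh, c, hc, hhc⟩ : ∃ h ∈ curlFreeFlows G,
      ∃ c ∈ (innerWForm G w).orthogonal (curlFreeFlows G), h + c = Y - gradFlow G s :=
    Submodule.mem_sup.1 <| (isCompl_curlFreeFlows_orthogonal hw_pos).sup_eq_top ▸ Submodule.mem_top
  have hc_orth : ∀ Z ∈ curlFreeFlows G, innerW G w c Z = 0 := fun Z hZ => by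
    rw [innerW_comm]
    exact hc Z hZ
  have hc_eq : c = Y - gradFlow G s - h := eq_sub_of_add_eq' hhc
  have hh_eq : h = Y - gradFlow G s - c := eq_sub_of_add_eq hhc
  refine ⟨(h, c), ⟨⟨hh.1, hh.2, hh.1.divW_eq_zero hw_symm fun t => ?_⟩,
    ⟨hc_eq ▸ hR.sub hh.1, fun Z hZ hZc => hc_orth Z ⟨hZ, hZc⟩⟩,
    fun i j => (congrFun (congrFun hhc i) j).symm, ?_⟩, ?_⟩
  · rw [hh_eq, innerW_sub_left, horth, hc_orth _ (gradFlow_mem_curlFreeFlows t), sub_zero]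
  · rw [innerW_comm]
    exact hc_orth h hh
  · rintro ⟨h', c'⟩ ⟨⟨hh', hh'c, -⟩, ⟨-, hc'⟩, hsum, -⟩
    have hsum' : h' + c' = Y - gradFlow G s := by
      funext i j
      exact (hsum i j).symm
    have hmem : h - h' ∈ curlFreeFlows G := sub_mem hh ⟨hh', hh'c⟩
    have hdiff : h - h' = c' - c := by
      rw [sub_eq_sub_iff_add_eq_add, hhc, ← hsum', add_comm]
    have hzero : h - h' = 0 := by
      refine hmem.1.eq_zero_of_innerW_self hw_pos ?_
      nth_rewrite 1 [hdiff]
      rw [innerW_sub_left, hc' _ hmem.1 hmem.2, hc_orth _ hmem, sub_zero]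
    exact Prod.ext (sub_eq_zero.1 hzero).symm (sub_eq_zero.1 (hdiff ▸ hzero))
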